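/- Let V be a finite dimensional complex vector space, d a positive integer, and W ⊂ Sym^d(V) a linear subspace such that the partial linear system P(W) ⊂ |O_{P(V)}(d)| on P(V) is base point free, i.e., for every z ∈ P(V) there exists s_z ∈ W with s_z(z) ≠ 0 in O_{P(V)}(d)_z. Let H ⊂ GL(V) be a subgroup that fixes W pointwise (under the natural action of GL(V) on Sym^d(V)). Then H is a finite group. -/

import Mathlib

open MvPolynomial in
/-- If forms of a fixed positive degree generate an ideal whose radical contains all the variables,
then the polynomial ring is integral over the algebra generated by these forms. -/
theorem MvPolynomial.isIntegral_adjoin_of_X_mem_radical {σ R : Type*} [Finite σ] [CommRing R]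
    {d : ℕ} (hd : 1 ≤ d) {P : Set (MvPolynomial σ R)} (hP : ∀ p ∈ P, p.IsHomogeneous d)
    (hrad : ∀ i, X i ∈ (Ideal.span P).radical) (q : MvPolynomial σ R) :
    IsIntegral (Algebra.adjoin R P) q := by
  classical
  have hle : idealOfVars σ R ≤ (Ideal.span P).radical := by
    refine Ideal.span_le.2 ?_
    rintro _ ⟨i, rfl⟩
    exact hrad i
  obtain ⟨N, hN⟩ := Ideal.exists_pow_le_of_le_radical_of_fg hle (idealOfVars_fg σ R)
  let M : Submodule (Algebra.adjoin R P) (MvPolynomial σ R) :=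
    Submodule.span _ (restrictTotalDegree σ R N : Set (MvPolynomial σ R))
  have hM : M.FG := by
    obtain ⟨S, hS⟩ := Module.Finite.iff_fg.1
      (inferInstance : Module.Finite R (restrictTotalDegree σ R N))
    refine ⟨S, le_antisymm (Submodule.span_mono ?_) (Submodule.span_le.2 ?_)⟩
    · rw [← hS]; exact Submodule.subset_span
    · rw [← hS]
      exact Submodule.span_subset_span R _ _
  have hcomp : ∀ k (q : MvPolynomial σ R), homogeneousComponent k q ∈ M := by
    intro k
    induction k using Nat.strong_induction_on with
    | _ k ih =>
      intro q
      rcases le_or_gt k N with hk | hk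
      · refine Submodule.subset_span ?_
        rw [SetLike.mem_coe, mem_restrictTotalDegree]
        exact (homogeneousComponent_isHomogeneous k q).totalDegree_le.trans hk
      · have hspan : ∀ f ∈ Ideal.span P, ∀ a, homogeneousComponent k (a * f) ∈ M := by
          intro f hf
          induction hf using Submodule.span_induction with
          | mem p hp =>
            intro a
            let := gradedAlgebra (σ := σ) (R := R)
            have h := DirectSum.coe_decompose_mul_of_right_mem (homogeneousSubmodule σ R) k
              (a := a) (hP p hp)
            have hdec : ∀ n (g : MvPolynomial σ R),
                (DirectSum.decompose (homogeneousSubmodule σ R) g n : MvPolynomial σ R) =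
                  homogeneousComponent n g := fun n g => decomposition.decompose'_apply g n
            rw [hdec, hdec] at h
            rw [h]
            split_ifs
            · rw [mul_comm]
              exact M.smul_mem ⟨p, Algebra.subset_adjoin hp⟩ (ih (k - d) (by omega) a)
            · exact M.zero_mem
          | zero => simp
          | add f g _ _ hf hg =>
            intro a
            rw [mul_add, map_add]
            exact M.add_mem (hf a) (hg a)
          | smul c f _ hf =>
            intro a
            rw [smul_eq_mul, ← mul_assoc]
            exact hf (a * c)
        have hq : homogeneousComponent k q ∈ Ideal.span P := by
          refine hN ((mem_pow_idealOfVars_iff _ _).2 fun x hx => ?_)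
          rw [support_homogeneousComponent, Finset.mem_filter] at hx
          omega
        have := hspan _ hq 1
        rwa [one_mul, homogeneousComponent_of_mem (homogeneousComponent_isHomogeneous k q), if_pos rfl]
          at this
  have htop : M = ⊤ := by
    refine eq_top_iff.2 fun f _ => ?_
    rw [← sum_homogeneousComponent f]
    exact M.sum_mem fun k _ => hcomp k f
  have : Module.Finite (Algebra.adjoin R P) (MvPolynomial σ R) := ⟨htop ▸ hM⟩
  exact IsIntegral.of_finite _ q

open MvPolynomial in
/-- Forms of a fixed positive degree over an algebraically closed field whose only common zero is
the origin define a map with finite fibers. -/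
theorem MvPolynomial.finite_setOf_eval_eq {σ K : Type*} [Finite σ] [Field K] [IsAlgClosed K]
    {d : ℕ} (hd : 1 ≤ d) {P : Set (MvPolynomial σ K)} (hP : ∀ p ∈ P, p.IsHomogeneous d)
    (hzero : ∀ x : σ → K, x ≠ 0 → ∃ p ∈ P, eval x p ≠ 0) (x : σ → K) :
    {y : σ → K | ∀ p ∈ P, eval y p = eval x p}.Finite := by
  classical
  have hrad : ∀ i, X i ∈ (Ideal.span P).radical := by
    intro i
    rw [← vanishingIdeal_zeroLocus_eq_radical (K := K)]
    intro z hz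
    obtain rfl : z = 0 := by
      by_contra h
      obtain ⟨p, hp, hpz⟩ := hzero z h
      exact hpz (by simpa [aeval_eq_eval] using hz p (Ideal.subset_span hp))
    simp
  choose f hf hfX using fun i => isIntegral_adjoin_of_X_mem_radical hd hP hrad (X i)
  let ev (y : σ → K) : Algebra.adjoin K P →+* K :=
    (eval y).comp (Algebra.adjoin K P).val.toRingHom
  refine (Set.Finite.pi' fun i => ((f i).map (ev x)).roots.toFinset.finite_toSet).subset ?_
  intro y hy i
  have hev : ev y = ev x := by
    have hle : Algebra.adjoin K P ≤ AlgHom.equalizer (aeval (R := K) y) (aeval x) :=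
      Algebra.adjoin_le fun p hp => by simpa [aeval_eq_eval] using hy p hp
    ext a
    simpa [ev, aeval_eq_eval] using hle a.2
  have hroot : Polynomial.eval₂ (ev y) (eval y (X i)) (f i) = 0 := by
    have := congrArg (eval y) (hfX i)
    rwa [Polynomial.hom_eval₂, map_zero] at this
  rw [hev, eval_X] at hroot
  simpa [Polynomial.mem_roots', Polynomial.eval_map, ((hf i).map (ev x)).ne_zero] using hroot

/-!
**Statement 5.**  `V` is a finite dimensional complex vector space and `d ≥ 1`.
Since `ℂ` has characteristic zero, the symmetric power `Sym^d(V)`, viewed as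
the space `H⁰(P(V), O_{P(V)}(d))` of global sections of `O_{P(V)}(d)` on the
projective space `P(V)` of one-dimensional quotients of `V`, is canonically
identified with the linear span of the degree-`d` power functions
`φ ↦ φ(v)^d` (`v ∈ V`) inside the space of functions on `V* = Module.Dual ℂ V`
(an element `s ∈ Sym^d(V)` corresponds to the polynomial function
`φ ↦ Sym^d(φ)(s)`, and the value of the section `s` at the point of `P(V)`
given by a one-dimensional quotient `φ : V → ℂ` is `Sym^d(φ)(s)`).  Under this
identification the natural `GL(V)`-action on `Sym^d(V)` becomes
`(g • s)(φ) = s(φ ∘ g)`.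

A linear subspace `W ⊂ Sym^d(V)` is base point free if for every `z ∈ P(V)`,
i.e. for every nonzero `φ ∈ V*` (up to scalar), some `s ∈ W` has `s(φ) ≠ 0`.
If a subgroup `H ⊂ GL(V)` fixes a base point free subspace `W` pointwise, then
`H` is a finite group. -/
theorem finite_of_fixes_basePointFree_subspace_of_symPow
    (V : Type*) [AddCommGroup V] [Module ℂ V] [FiniteDimensional ℂ V]
    (d : ℕ) (hd : 1 ≤ d)
    (W : Submodule ℂ (Module.Dual ℂ V → ℂ))
    (hW : W ≤ Submodule.span ℂ
      {f : Module.Dual ℂ V → ℂ | ∃ v : V, f = fun φ => (φ v) ^ d})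
    (hbpf : ∀ φ : Module.Dual ℂ V, φ ≠ 0 → ∃ s ∈ W, s φ ≠ 0)
    (H : Subgroup (LinearMap.GeneralLinearGroup ℂ V))
    (hH : ∀ g ∈ H, ∀ s ∈ W, ∀ φ : Module.Dual ℂ V,
      s (φ ∘ₗ (g : V →ₗ[ℂ] V)) = s φ) :
    Finite H := by
  classical
  let b := Module.finBasis ℂ V
  let Φ : MvPolynomial (Fin (Module.finrank ℂ V)) ℂ →ₐ[ℂ] (Module.Dual ℂ V → ℂ) :=
    MvPolynomial.aeval fun i φ => φ (b i)
  have hΦ : ∀ p φ, Φ p φ = MvPolynomial.eval (fun i => φ (b i)) p := by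
    intro p φ
    have : (Pi.evalAlgHom ℂ (fun _ : Module.Dual ℂ V => ℂ) φ).comp Φ =
        MvPolynomial.aeval fun i => φ (b i) := by
      ext i
      simp [Φ]
    simpa [MvPolynomial.aeval_eq_eval] using DFunLike.congr_fun this p
  have hWΦ : W ≤ (MvPolynomial.homogeneousSubmodule _ ℂ d).map Φ.toLinearMap := by
    refine hW.trans (Submodule.span_le.2 ?_)
    rintro _ ⟨v, rfl⟩
    refine ⟨(∑ i, MvPolynomial.C (b.repr v i) * MvPolynomial.X i) ^ d, ?_, ?_⟩
    · have : (∑ i, MvPolynomial.C (b.repr v i) * MvPolynomial.X i).IsHomogeneous 1 :=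
        MvPolynomial.IsHomogeneous.sum _ _ _ fun i _ => MvPolynomial.isHomogeneous_C_mul_X _ i
      simpa using this.pow d
    · ext φ
      rw [AlgHom.toLinearMap_apply, hΦ]
      have hv : φ v = ∑ i, b.repr v i * φ (b i) := by
        conv_lhs => rw [← b.sum_repr v]
        simp only [map_sum, map_smul, smul_eq_mul]
      simp [hv]
  let P : Set (MvPolynomial (Fin (Module.finrank ℂ V)) ℂ) := {p | p.IsHomogeneous d ∧ Φ p ∈ W}
  have hzero : ∀ x, x ≠ 0 → ∃ p ∈ P, MvPolynomial.eval x p ≠ 0 := by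
    intro x hx
    have hφ : (fun i => b.constr ℂ x (b i)) = x := funext fun i => b.constr_basis ℂ x i
    obtain ⟨s, hs, hsx⟩ := hbpf (b.constr ℂ x) fun h => hx <| by
      rw [← hφ, h]
      rfl
    obtain ⟨p, hp, rfl⟩ := hWΦ hs
    refine ⟨p, ⟨hp, hs⟩, ?_⟩
    rwa [AlgHom.toLinearMap_apply, hΦ, hφ] at hsx
  let F (g : H) (j i : Fin (Module.finrank ℂ V)) : ℂ :=
    b.coord j ((g : LinearMap.GeneralLinearGroup ℂ V).1 (b i))
  have hfin : (Set.range F).Finite := by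
    refine (Set.Finite.pi' fun j => MvPolynomial.finite_setOf_eval_eq hd (P := P)
      (fun p hp => hp.1) hzero fun i => b.coord j (b i)).subset ?_
    rintro _ ⟨g, rfl⟩ j p hp
    have := hH g g.2 _ hp.2 (b.coord j)
    rwa [hΦ, hΦ] at this
  have hinj : Function.Injective F := by
    intro g h hgh
    refine Subtype.ext (Units.ext (b.ext fun i => b.ext_elem fun j => ?_))
    exact congrFun (congrFun hgh j) i
  have := hfin.to_subtype
  exact Finite.of_injective _ (Set.rangeFactorization_injective.2 hinj)
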